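/- For every α > 1, the Tsallis entropy of the Poisson distribution satisfies (1/(α-1))·(1 - (2π·⌊λ⌋)^{(1-α)/2}) ≤ H_T(α,λ) < 1/(α-1) for all λ ≥ 1, and consequently lim_{λ→∞} H_T(α,λ) = 1/(α-1). -/

import Mathlib

open Real Filter Topology

/-- The Poisson probabilities `p_i(λ) = e^{-λ} λ^i / i!`. -/
noncomputable def poissonP (l : ℝ) (i : ℕ) : ℝ :=
  Real.exp (-l) * l ^ i / (Nat.factorial i)

/-- `ψ(α,λ) = ∑_{i=0}^∞ (p_i(λ))^α`. -/
noncomputable def psiPoisson (α l : ℝ) : ℝ :=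
  ∑' i, (poissonP l i) ^ α

theorem poissonP_pos {l : ℝ} (hl : 0 < l) (i : ℕ) : 0 < poissonP l i := by
  unfold poissonP
  positivity

theorem hasSum_poissonP (l : ℝ) : HasSum (poissonP l) 1 := by
  have h := (NormedSpace.expSeries_div_hasSum_exp (𝔸 := ℝ) l).mul_left (Real.exp (-l))
  rw [← Real.exp_eq_exp_ℝ, ← Real.exp_add, neg_add_cancel, Real.exp_zero] at h
  exact h.congr_fun fun i => (mul_div_assoc _ _ _)

theorem poissonP_succ (l : ℝ) (i : ℕ) :
    poissonP l (i + 1) = poissonP l i * (l / (i + 1)) := by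
  unfold poissonP
  rw [Nat.factorial_succ]
  push_cast
  field_simp
  ring

/-- The integer part of the parameter is a mode of the Poisson distribution. -/
theorem poissonP_le_poissonP_floor {l : ℝ} (hl : 0 < l) (i : ℕ) :
    poissonP l i ≤ poissonP l ⌊l⌋₊ := by
  rcases le_total i ⌊l⌋₊ with hi | hi
  · induction hi using Nat.decreasingInduction with
    | self => exact le_rfl
    | of_succ k hk ih =>
      refine le_trans ?_ ih
      rw [poissonP_succ]
      refine le_mul_of_one_le_right (poissonP_pos hl k).le ?_
      rw [one_le_div (by positivity)]
      exact_mod_cast (Nat.le_floor_iff hl.le).1 (Nat.succ_le_of_lt hk)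
  · induction i, hi using Nat.le_induction with
    | base => exact le_rfl
    | succ k hk ih =>
      refine le_trans ?_ ih
      rw [poissonP_succ]
      refine mul_le_of_le_one_right (poissonP_pos hl k).le ?_
      rw [div_le_one (by positivity)]
      exact_mod_cast ((Nat.floor_lt hl.le).1 (Nat.lt_succ_of_le hk)).le

theorem exp_neg_mul_pow_le {l : ℝ} (hl : 0 ≤ l) {n : ℕ} (hn : n ≠ 0) :
    Real.exp (-l) * l ^ n ≤ (n / Real.exp 1) ^ n := by
  have hn' : (0 : ℝ) < n := by positivity
  have h1 : l / n ≤ Real.exp (l / n - 1) := by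
    simpa using Real.add_one_le_exp (l / n - 1)
  have h2 : (l / n) ^ n ≤ Real.exp (l - n) := by
    refine (pow_le_pow_left₀ (by positivity) h1 n).trans_eq ?_
    rw [← Real.exp_nat_mul]
    congr 1
    field_simp
  rw [div_pow, div_le_iff₀ (by positivity)] at h2
  rw [div_pow, ← Real.exp_nat_mul, mul_one, le_div_iff₀ (Real.exp_pos _)]
  calc Real.exp (-l) * l ^ n * Real.exp n
      ≤ Real.exp (-l) * (Real.exp (l - n) * n ^ n) * Real.exp n := by gcongr
    _ = Real.exp (-l + (l - n) + n) * n ^ n := by rw [Real.exp_add, Real.exp_add]; ring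
    _ = n ^ n := by rw [show -l + (l - n) + n = 0 by ring, Real.exp_zero, one_mul]

theorem poissonP_le_inv_sqrt {l : ℝ} (hl : 0 ≤ l) {n : ℕ} (hn : n ≠ 0) :
    poissonP l n ≤ (√(2 * π * n))⁻¹ := by
  have hs : 0 < √(2 * π * n) := by positivity
  unfold poissonP
  rw [div_le_iff₀ (by positivity), le_inv_mul_iff₀ hs]
  exact (mul_le_mul_of_nonneg_left (exp_neg_mul_pow_le hl hn) hs.le).trans
    (Stirling.le_factorial_stirling n)

theorem poissonP_rpow_le {α l : ℝ} (hα : 1 ≤ α) (hl : 1 ≤ l) (i : ℕ) :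
    poissonP l i ^ α ≤ (2 * π * (⌊l⌋₊ : ℝ)) ^ ((1 - α) / 2) * poissonP l i := by
  have hl0 : 0 < l := by linarith
  have hn : ⌊l⌋₊ ≠ 0 := (Nat.floor_pos.2 hl).ne'
  have hp := poissonP_pos hl0 i
  have h : poissonP l i ≤ (2 * π * (⌊l⌋₊ : ℝ)) ^ (-(1 / 2) : ℝ) := by
    rw [Real.rpow_neg (by positivity), ← Real.sqrt_eq_rpow]
    exact (poissonP_le_poissonP_floor hl0 i).trans (poissonP_le_inv_sqrt hl0.le hn)
  calc poissonP l i ^ α = poissonP l i ^ (α - 1) * poissonP l i := by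
        rw [Real.rpow_sub_one hp.ne', div_mul_cancel₀ _ hp.ne']
    _ ≤ ((2 * π * (⌊l⌋₊ : ℝ)) ^ (-(1 / 2) : ℝ)) ^ (α - 1) * poissonP l i := by
        gcongr
    _ = (2 * π * (⌊l⌋₊ : ℝ)) ^ ((1 - α) / 2) * poissonP l i := by
        rw [← Real.rpow_mul (by positivity)]
        ring_nf

theorem summable_poissonP_rpow {α l : ℝ} (hα : 1 ≤ α) (hl : 1 ≤ l) :
    Summable fun i => poissonP l i ^ α :=
  Summable.of_nonneg_of_le
    (fun i => Real.rpow_nonneg (poissonP_pos (by linarith) i).le α)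
    (poissonP_rpow_le hα hl) ((hasSum_poissonP l).summable.mul_left _)

theorem psiPoisson_pos {α l : ℝ} (hα : 1 ≤ α) (hl : 1 ≤ l) : 0 < psiPoisson α l :=
  have hpos (i : ℕ) : 0 < poissonP l i ^ α := Real.rpow_pos_of_pos (poissonP_pos (by linarith) i) α
  (summable_poissonP_rpow hα hl).tsum_pos (fun i => (hpos i).le) 0 (hpos 0)

theorem psiPoisson_le {α l : ℝ} (hα : 1 ≤ α) (hl : 1 ≤ l) :
    psiPoisson α l ≤ (2 * π * (⌊l⌋₊ : ℝ)) ^ ((1 - α) / 2) := by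
  have h := (hasSum_poissonP l).mul_left ((2 * π * (⌊l⌋₊ : ℝ)) ^ ((1 - α) / 2))
  rw [mul_one] at h
  exact hasSum_le (poissonP_rpow_le hα hl) (summable_poissonP_rpow hα hl).hasSum h

theorem tendsto_psiPoisson_atTop {α : ℝ} (hα : 1 < α) :
    Tendsto (psiPoisson α) atTop (𝓝 0) := by
  have hbase : Tendsto (fun l : ℝ => 2 * π * (⌊l⌋₊ : ℝ)) atTop atTop :=
    (tendsto_natCast_atTop_atTop.comp tendsto_nat_floor_atTop).const_mul_atTop (by positivity)
  have hbound := (tendsto_rpow_neg_atTop (y := (α - 1) / 2) (by linarith)).comp hbase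
  refine tendsto_of_tendsto_of_tendsto_of_le_of_le' tendsto_const_nhds hbound ?_ ?_
  · filter_upwards [eventually_ge_atTop 1] with l hl using (psiPoisson_pos hα.le hl).le
  · filter_upwards [eventually_ge_atTop 1] with l hl
    refine (psiPoisson_le hα.le hl).trans_eq ?_
    simp only [Function.comp_apply]
    congr 1
    ring

/-- bounds and limit for the Tsallis entropy of the Poisson
distribution when α > 1. -/
theorem tsallis_poisson_bounds_limit (α : ℝ) (hα : 1 < α) :
    (∀ l : ℝ, 1 ≤ l →
      (1 / (α - 1)) * (1 - (2 * Real.pi * (Nat.floor l : ℝ)) ^ ((1 - α) / 2)) ≤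
        (1 - α)⁻¹ * (psiPoisson α l - 1) ∧
      (1 - α)⁻¹ * (psiPoisson α l - 1) < 1 / (α - 1)) ∧
    Tendsto (fun l : ℝ => (1 - α)⁻¹ * (psiPoisson α l - 1)) atTop
      (𝓝 (1 / (α - 1))) := by
  have hα' : 0 < 1 / (α - 1) := one_div_pos.2 (by linarith)
  have hH (l : ℝ) : (1 - α)⁻¹ * (psiPoisson α l - 1) = 1 / (α - 1) * (1 - psiPoisson α l) := by
    rw [← neg_sub α 1, inv_neg, one_div]
    ring
  simp only [hH]
  refine ⟨fun l hl => ⟨?_, ?_⟩, ?_⟩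
  · exact mul_le_mul_of_nonneg_left (sub_le_sub_left (psiPoisson_le hα.le hl) 1) hα'.le
  · exact mul_lt_of_lt_one_right hα' (sub_lt_self 1 (psiPoisson_pos hα.le hl))
  · simpa using ((tendsto_psiPoisson_atTop hα).const_sub 1).const_mul (1 / (α - 1))
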